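/- Let V be a category with finite products and small coproducts such that finite products commute with small coproducts. Then the forgetful functor from the category V-Cat of V-enriched categories and V-functors to the category V-Gph of V-graphs is monadic, and the induced free V-category monad fc_V acts as the identity on object sets and on hom-objects by (fc_V A)(a, a') = ∐_{k ≥ 0} ∐_{a = a₀, a₁, …, a_{k-1}, a_k = a'} A(a_{k-1}, a_k) × ⋯ × A(a₀, a₁). -/

import Mathlib

/-!
STATEMENT 6: If `V` has finite products and small coproducts commuting with finite
products, then the forgetful functor `V-Cat → V-Gph` is monadic, and the induced
free `V`-category monad acts as the identity on object sets and on hom-objects by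
`(fc_V A)(a, a') = ∐_{k ≥ 0} ∐_{a = a₀, …, a_k = a'} A(a_{k-1}, a_k) × ⋯ × A(a₀, a₁)`.
-/

open CategoryTheory Limits

universe v u

structure VGph (V : Type u) [Category.{v} V] where
  Obj : Type
  hom : Obj → Obj → V

variable {V : Type u} [Category.{v} V]

structure VGphHom (A B : VGph V) where
  toFun : A.Obj → B.Obj
  app : ∀ a a', A.hom a a' ⟶ B.hom (toFun a) (toFun a')

theorem VGphHom.ext' {A B : VGph V} {F G : VGphHom A B}
    (h : F.toFun = G.toFun) (h2 : HEq F.app G.app) : F = G := by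
  cases F; cases G; cases h; cases h2; rfl

instance : Category (VGph V) where
  Hom := VGphHom
  id A := ⟨fun a => a, fun a a' => 𝟙 _⟩
  comp F G := ⟨fun a => G.toFun (F.toFun a), fun a a' => F.app a a' ≫ G.app _ _⟩
  id_comp F := VGphHom.ext' rfl (heq_of_eq (by funext a a'; simp))
  comp_id F := VGphHom.ext' rfl (heq_of_eq (by funext a a'; simp))
  assoc F G H := VGphHom.ext' rfl (heq_of_eq (by funext a a'; simp))

section
variable (V) [HasFiniteProducts V]

/-- A category enriched in a cartesian category `V` (a `V`-category). -/
structure VCat where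
  Obj : Type
  hom : Obj → Obj → V
  eId : ∀ a, (⊤_ V) ⟶ hom a a
  comp : ∀ a b c, hom b c ⨯ hom a b ⟶ hom a c
  comp_unit : ∀ a b,
    prod.lift (terminal.from (hom a b) ≫ eId b) (𝟙 (hom a b)) ≫ comp a b b =
      𝟙 (hom a b)
  unit_comp : ∀ a b,
    prod.lift (𝟙 (hom a b)) (terminal.from (hom a b) ≫ eId a) ≫ comp a a b =
      𝟙 (hom a b)
  comp_assoc : ∀ a b c d,
    prod.map (comp b c d) (𝟙 (hom a b)) ≫ comp a b d =
      (Limits.prod.associator _ _ _).hom ≫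
        prod.map (𝟙 (hom c d)) (comp a b c) ≫ comp a c d

variable {V}

/-- A (strict) `V`-functor between `V`-categories. -/
structure VCatHom (A B : VCat V) where
  toFun : A.Obj → B.Obj
  app : ∀ a a', A.hom a a' ⟶ B.hom (toFun a) (toFun a')
  map_id : ∀ a, A.eId a ≫ app a a = B.eId (toFun a)
  map_comp : ∀ a b c,
    A.comp a b c ≫ app a c = prod.map (app b c) (app a b) ≫ B.comp _ _ _

theorem VCatHom.ext' {A B : VCat V} {F G : VCatHom A B}
    (h : F.toFun = G.toFun) (h2 : HEq F.app G.app) : F = G := by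
  cases F; cases G; cases h; cases h2; rfl

instance : Category (VCat V) where
  Hom := VCatHom
  id A := ⟨fun a => a, fun a a' => 𝟙 _, by simp, by simp⟩
  comp F G := ⟨fun a => G.toFun (F.toFun a), fun a a' => F.app a a' ≫ G.app _ _,
    fun a => by rw [← Category.assoc, F.map_id, G.map_id],
    fun a b c => by
      rw [← Category.assoc, F.map_comp, Category.assoc, G.map_comp,
        ← Category.assoc, prod.map_map]⟩
  id_comp F := VCatHom.ext' rfl (heq_of_eq (by funext a a'; simp))
  comp_id F := VCatHom.ext' rfl (heq_of_eq (by funext a a'; simp))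
  assoc F G H := VCatHom.ext' rfl (heq_of_eq (by funext a a'; simp))

/-- The forgetful functor from `V`-categories to `V`-graphs. -/
def forgetToGph : VCat V ⥤ VGph V where
  obj A := ⟨A.Obj, A.hom⟩
  map F := ⟨F.toFun, F.app⟩
  map_id _ := rfl
  map_comp _ _ := rfl

/-- The indexing data for the free `V`-category formula: pairs of a natural number
`k` and a chain `a = a₀, a₁, …, a_k = a'` of objects. -/
def Chains (A : VGph V) (a a' : A.Obj) : Type :=
  Σ k : ℕ, { c : Fin (k + 1) → A.Obj // c 0 = a ∧ c (Fin.last k) = a' }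

variable [HasCoproducts.{0} V]

/-- The value prescribed by the free `V`-category formula on hom-objects:
`∐_{k ≥ 0} ∐_{a = a₀, …, a_k = a'} A(a_{k-1}, a_k) × ⋯ × A(a₀, a₁)`. -/
noncomputable def freeHomObj (A : VGph V) (a a' : A.Obj) : V :=
  ∐ fun c : Chains A a a' =>
    ∏ᶜ fun i : Fin c.1 => A.hom (c.2.1 i.castSucc) (c.2.1 i.succ)

end

section Helpers

attribute [local simp] prod.lift_fst prod.lift_snd prod.lift_fst_assoc prod.lift_snd_assoc

variable [HasFiniteProducts V]

/-- Paths (chains of objects) from `a`, built by adding vertices at the end. -/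
inductive Pth (X : Type) (a : X) : X → Type
  | nil : Pth X a a
  | cons {b : X} (p : Pth X a b) (c : X) : Pth X a c

/-- Product of the homs along a path. -/
noncomputable def Pth.obj (A : VGph V) {a : A.Obj} : {b : A.Obj} → Pth A.Obj a b → V
  | _, .nil => ⊤_ V
  | _, .cons (b := b) p c => A.hom b c ⨯ Pth.obj A p

variable [HasCoproducts.{0} V]

section Dist
variable [∀ (X : V) (J : Type), PreservesColimitsOfShape (Discrete J) (prod.functor.obj X)]

noncomputable def distR {J : Type} {P : J → V} (X : V) {Z : V} (f : ∀ j, X ⨯ P j ⟶ Z) :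
    X ⨯ (∐ P) ⟶ Z :=
  Cofan.IsColimit.desc (isColimitOfHasCoproductOfPreservesColimit (prod.functor.obj X) P) f

theorem distR_fac {J : Type} {P : J → V} (X : V) {Z : V} (f : ∀ j, X ⨯ P j ⟶ Z) (j : J) :
    prod.map (𝟙 X) (Sigma.ι P j) ≫ distR X f = f j :=
  Cofan.IsColimit.fac (isColimitOfHasCoproductOfPreservesColimit (prod.functor.obj X) P) f j

theorem distR_ext {J : Type} {P : J → V} {X : V} {Z : V} {f g : X ⨯ (∐ P) ⟶ Z}
    (h : ∀ j, prod.map (𝟙 X) (Sigma.ι P j) ≫ f = prod.map (𝟙 X) (Sigma.ι P j) ≫ g) : f = g :=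
  Cofan.IsColimit.hom_ext
    (isColimitOfHasCoproductOfPreservesColimit (prod.functor.obj X) P) _ _ h

noncomputable def distL {J : Type} {P : J → V} (X : V) {Z : V} (f : ∀ j, P j ⨯ X ⟶ Z) :
    (∐ P) ⨯ X ⟶ Z :=
  (prod.braiding _ _).hom ≫ distR X (fun j => (prod.braiding _ _).hom ≫ f j)

theorem distL_fac {J : Type} {P : J → V} (X : V) {Z : V} (f : ∀ j, P j ⨯ X ⟶ Z) (j : J) :
    prod.map (Sigma.ι P j) (𝟙 X) ≫ distL X f = f j := by
  have h := distR_fac X (fun j => (prod.braiding _ _).hom ≫ f j) j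
  have h2 : prod.map (Sigma.ι P j) (𝟙 X) ≫ (prod.braiding _ _).hom =
    (prod.braiding _ _).hom ≫ prod.map (𝟙 X) (Sigma.ι P j) := by
    ext <;> simp
  rw [distL, reassoc_of% h2, h, ← Category.assoc, prod.symmetry, Category.id_comp]

theorem distL_ext {J : Type} {P : J → V} {X : V} {Z : V} {f g : (∐ P) ⨯ X ⟶ Z}
    (h : ∀ j, prod.map (Sigma.ι P j) (𝟙 X) ≫ f = prod.map (Sigma.ι P j) (𝟙 X) ≫ g) : f = g := by
  rw [← cancel_epi (prod.braiding _ _).hom]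
  apply distR_ext
  intro j
  have h2 : prod.map (𝟙 X) (Sigma.ι P j) ≫ (prod.braiding _ _).hom =
    (prod.braiding _ _).hom ≫ prod.map (Sigma.ι P j) (𝟙 X) := by
    ext <;> simp
  rw [reassoc_of% h2, reassoc_of% h2, h]

theorem dist3_ext {J : Type} {P : J → V} {Y X : V} {Z : V} {f g : (Y ⨯ (∐ P)) ⨯ X ⟶ Z}
    (h : ∀ j, prod.map (prod.map (𝟙 Y) (Sigma.ι P j)) (𝟙 X) ≫ f =
      prod.map (prod.map (𝟙 Y) (Sigma.ι P j)) (𝟙 X) ≫ g) : f = g := by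
  rw [← cancel_epi ((Limits.prod.associator X Y (∐ P)).hom ≫ (prod.braiding _ _).hom)]
  simp only [Category.assoc]
  apply distR_ext
  intro j
  have h2 : prod.map (𝟙 (X ⨯ Y)) (Sigma.ι P j) ≫ (Limits.prod.associator _ _ _).hom ≫
      (prod.braiding _ _).hom = (Limits.prod.associator _ _ _).hom ≫
      (prod.braiding _ _).hom ≫ prod.map (prod.map (𝟙 Y) (Sigma.ι P j)) (𝟙 X) := by
    ext <;> simp
  have h3 := fun (k : (Y ⨯ (∐ P)) ⨯ X ⟶ Z) => congrArg (fun t => t ≫ k) h2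
  simp only [Category.assoc] at h3
  rw [h3 f, h3 g, h]

end Dist

/-- Hom objects of the free category. -/
noncomputable def FH (A : VGph V) (a b : A.Obj) : V := ∐ fun p : Pth A.Obj a b => p.obj A

noncomputable def FHι (A : VGph V) {a b : A.Obj} (p : Pth A.Obj a b) : p.obj A ⟶ FH A a b :=
  Sigma.ι (fun p : Pth A.Obj a b => p.obj A) p

noncomputable def FHe (A : VGph V) (a : A.Obj) : ⊤_ V ⟶ FH A a a := FHι A (Pth.nil (a := a))

variable [∀ (X : V) (J : Type), PreservesColimitsOfShape (Discrete J) (prod.functor.obj X)]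

noncomputable def FHs (A : VGph V) (a b c : A.Obj) : A.hom b c ⨯ FH A a b ⟶ FH A a c :=
  distR _ (fun p => FHι A (.cons p c))

noncomputable def FHιc (A : VGph V) {a b : A.Obj} (p : Pth A.Obj a b) (c : A.Obj) :
    A.hom b c ⨯ p.obj A ⟶ FH A a c := FHι A (.cons p c)

theorem FHs_fac (A : VGph V) {a b : A.Obj} (p : Pth A.Obj a b) (c : A.Obj) :
    prod.map (𝟙 _) (FHι A p) ≫ FHs A a b c = FHιc A p c :=
  distR_fac (A.hom b c) (fun p : Pth A.Obj a b => FHι A (.cons p c)) p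

section Rec
variable (A : VGph V) {a : A.Obj} {X : V} {Z : A.Obj → V} (z : X ⟶ Z a)
  (t : ∀ b c, A.hom b c ⨯ Z b ⟶ Z c)

noncomputable def recP : {b : A.Obj} → (p : Pth A.Obj a b) → (p.obj A ⨯ X ⟶ Z b)
  | _, .nil => prod.snd ≫ z
  | _, .cons (b := b) p c => (Limits.prod.associator _ _ _).hom ≫ prod.map (𝟙 _) (recP p) ≫ t b c

noncomputable def FHrec (b : A.Obj) : FH A a b ⨯ X ⟶ Z b := distL X (fun p => recP A z t p)

theorem FHι_rec {b : A.Obj} (p : Pth A.Obj a b) :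
    prod.map (FHι A p) (𝟙 X) ≫ FHrec A z t b = recP A z t p :=
  distL_fac X (fun p => recP A z t p) p

theorem FHιc_rec {b : A.Obj} (p : Pth A.Obj a b) (c : A.Obj) :
    prod.map (FHιc A p c) (𝟙 X) ≫ FHrec A z t c =
      (Limits.prod.associator _ _ _).hom ≫ prod.map (𝟙 _) (recP A z t p) ≫ t b c :=
  FHι_rec A z t (.cons p c)

theorem FHrec_e : prod.map (FHe A a) (𝟙 X) ≫ FHrec A z t a = prod.snd ≫ z :=
  FHι_rec A z t .nil

theorem FHrec_s (b c : A.Obj) : prod.map (FHs A a b c) (𝟙 X) ≫ FHrec A z t c =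
    (Limits.prod.associator _ _ _).hom ≫ prod.map (𝟙 _) (FHrec A z t b) ≫ t b c := by
  apply dist3_ext
  intro p
  change prod.map (prod.map (𝟙 _) (FHι A p)) (𝟙 X) ≫ _ =
    prod.map (prod.map (𝟙 _) (FHι A p)) (𝟙 X) ≫ _
  have h2 : prod.map (prod.map (𝟙 (A.hom b c)) (FHι A p)) (𝟙 X) ≫ (Limits.prod.associator _ _ _).hom =
    (Limits.prod.associator _ _ _).hom ≫ prod.map (𝟙 _) (prod.map (FHι A p) (𝟙 X)) := by
    ext <;> simp
  rw [reassoc_of% h2, prod.map_map_assoc, prod.map_map_assoc, FHι_rec, FHs_fac,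
    Category.comp_id, Category.comp_id, FHιc_rec]

theorem FHrec_unique (g : ∀ b, FH A a b ⨯ X ⟶ Z b)
    (ge : prod.map (FHe A a) (𝟙 X) ≫ g a = prod.snd ≫ z)
    (gs : ∀ b c, prod.map (FHs A a b c) (𝟙 X) ≫ g c =
      (Limits.prod.associator _ _ _).hom ≫ prod.map (𝟙 _) (g b) ≫ t b c) (b : A.Obj) :
    g b = FHrec A z t b := by
  apply distL_ext
  intro p
  change prod.map (FHι A p) (𝟙 X) ≫ _ = prod.map (FHι A p) (𝟙 X) ≫ _
  rw [FHι_rec]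
  induction p with
  | nil => exact ge
  | @cons b p c ih =>
    change prod.map (FHιc A p c) (𝟙 X) ≫ g c =
      (Limits.prod.associator _ _ _).hom ≫ prod.map (𝟙 _) (recP A z t p) ≫ t b c
    have h1 : prod.map (FHιc A p c) (𝟙 X) =
      prod.map (prod.map (𝟙 _) (FHι A p)) (𝟙 X) ≫ prod.map (FHs A a b c) (𝟙 X) := by
      rw [← FHs_fac]; ext <;> simp
    have h2 : prod.map (prod.map (𝟙 (A.hom b c)) (FHι A p)) (𝟙 X) ≫
      (Limits.prod.associator _ _ _).hom =
      (Limits.prod.associator _ _ _).hom ≫ prod.map (𝟙 _) (prod.map (FHι A p) (𝟙 X)) := by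
      ext <;> simp
    rw [h1, Category.assoc, gs, reassoc_of% h2, prod.map_map_assoc, ih, Category.comp_id]
end Rec

section Rec0
variable (A : VGph V) {a : A.Obj} {Z : A.Obj → V} (z : ⊤_ V ⟶ Z a)
  (t : ∀ b c, A.hom b c ⨯ Z b ⟶ Z c)

noncomputable def FHrec0 (b : A.Obj) : FH A a b ⟶ Z b :=
  prod.lift (𝟙 _) (terminal.from _) ≫ FHrec A z t b

theorem FHrec0_e : FHe A a ≫ FHrec0 A z t a = z := by
  have : FHe A a ≫ prod.lift (𝟙 _) (terminal.from _) =
    prod.lift (𝟙 _) (𝟙 _) ≫ prod.map (FHe A a) (𝟙 _) := by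
    ext <;> simp
  rw [FHrec0, reassoc_of% this, FHrec_e]
  simp

theorem FHrec0_s (b c : A.Obj) : FHs A a b c ≫ FHrec0 A z t c =
    prod.map (𝟙 _) (FHrec0 A z t b) ≫ t b c := by
  have : FHs A a b c ≫ prod.lift (𝟙 _) (terminal.from _) =
    prod.lift (𝟙 _) (terminal.from _) ≫ prod.map (FHs A a b c) (𝟙 _) := by
    ext <;> simp
  rw [FHrec0, reassoc_of% this, FHrec_s, ← Category.assoc, ← Category.assoc]
  congr 1
  ext
  · simp
  · simp only [FHrec0, prod.map_snd, Category.assoc]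
    simp only [← Category.assoc]
    congr 1
    ext <;> simp

theorem FHrec0_unique (g : ∀ b, FH A a b ⟶ Z b) (ge : FHe A a ≫ g a = z)
    (gs : ∀ b c, FHs A a b c ≫ g c = prod.map (𝟙 _) (g b) ≫ t b c) (b : A.Obj) :
    g b = FHrec0 A z t b := by
  have := FHrec_unique A z t (fun b => prod.fst ≫ g b) (by
      rw [prod.map_fst_assoc, ge]; congr 1; ext) (by
      intro b c
      rw [prod.map_fst_assoc, gs, ← Category.assoc, ← Category.assoc]
      congr 1
      ext <;> simp) b
  rw [FHrec0, ← this]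
  simp
end Rec0

section FreeCat
variable (A : VGph V)

noncomputable def FHcomp (a b c : A.Obj) : FH A b c ⨯ FH A a b ⟶ FH A a c :=
  FHrec A (Z := FH A a) (𝟙 _) (FHs A a) c

theorem FHcomp_e (a b : A.Obj) : prod.map (FHe A b) (𝟙 _) ≫ FHcomp A a b b = prod.snd := by
  rw [FHcomp, FHrec_e, Category.comp_id]

theorem FHcomp_s (a b c d : A.Obj) : prod.map (FHs A b c d) (𝟙 _) ≫ FHcomp A a b d =
    (Limits.prod.associator _ _ _).hom ≫ prod.map (𝟙 _) (FHcomp A a b c) ≫ FHs A a c d := by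
  rw [FHcomp, FHrec_s]; rfl

theorem FHcomp_unit (a b : A.Obj) :
    prod.lift (terminal.from (FH A a b) ≫ FHe A b) (𝟙 _) ≫ FHcomp A a b b = 𝟙 _ := by
  have : prod.lift (terminal.from (FH A a b) ≫ FHe A b) (𝟙 (FH A a b)) =
    prod.lift (terminal.from _) (𝟙 _) ≫ prod.map (FHe A b) (𝟙 _) := by ext <;> simp
  rw [this, Category.assoc, FHcomp_e, prod.lift_snd]

theorem FHunit_comp (a b : A.Obj) :
    prod.lift (𝟙 _) (terminal.from (FH A a b) ≫ FHe A a) ≫ FHcomp A a a b = 𝟙 _ := by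
  rw [FHrec0_unique A (FHe A a) (FHs A a)
    (fun b => prod.lift (𝟙 _) (terminal.from (FH A a b) ≫ FHe A a) ≫ FHcomp A a a b) ?_ ?_ b]
  · symm
    exact FHrec0_unique A (FHe A a) (FHs A a) (fun b => 𝟙 (FH A a b)) (by simp) (by simp) b
  · have : FHe A a ≫ prod.lift (𝟙 _) (terminal.from (FH A a a) ≫ FHe A a) =
      prod.lift (𝟙 _) (FHe A a) ≫ prod.map (FHe A a) (𝟙 _) := by
      ext
      · simp
      · have : terminal.from (⊤_ V) = 𝟙 _ := by ext
        simp [this]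
    rw [reassoc_of% this, FHcomp_e, prod.lift_snd]
  · intro b c
    have : FHs A a b c ≫ prod.lift (𝟙 _) (terminal.from (FH A a c) ≫ FHe A a) =
      prod.lift (𝟙 _) (terminal.from _ ≫ FHe A a) ≫ prod.map (FHs A a b c) (𝟙 _) := by
      ext
      · simp
      · simp [← Category.assoc]
    rw [reassoc_of% this, FHcomp_s, ← Category.assoc, ← Category.assoc]
    congr 1
    ext
    · simp
    · simp only [prod.map_snd, Category.assoc]
      simp only [← Category.assoc]
      congr 1
      ext
      · simp
      · simp [← Category.assoc]

theorem FHcomp_assoc (a b c d : A.Obj) :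
    prod.map (FHcomp A b c d) (𝟙 (FH A a b)) ≫ FHcomp A a b d =
      (Limits.prod.associator _ _ _).hom ≫
        prod.map (𝟙 (FH A c d)) (FHcomp A a b c) ≫ FHcomp A a c d := by
  rw [← Iso.inv_comp_eq]
  have h1 := FHrec_unique A (FHcomp A a b c) (FHs A a)
    (fun d => (Limits.prod.associator _ _ _).inv ≫
      prod.map (FHcomp A b c d) (𝟙 (FH A a b)) ≫ FHcomp A a b d) ?_ ?_ d
  have h2 := FHrec_unique A (FHcomp A a b c) (FHs A a)
    (fun d => prod.map (𝟙 (FH A c d)) (FHcomp A a b c) ≫ FHcomp A a c d) ?_ ?_ d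
  · rw [h1, ← h2]
  · have : prod.map (FHe A c) (𝟙 _) ≫ prod.map (𝟙 (FH A c c)) (FHcomp A a b c) =
      prod.map (𝟙 _) (FHcomp A a b c) ≫ prod.map (FHe A c) (𝟙 _) := by ext <;> simp
    rw [reassoc_of% this, FHcomp_e, prod.map_snd]
  · intro d e
    have : prod.map (FHs A c d e) (𝟙 _) ≫ prod.map (𝟙 (FH A c e)) (FHcomp A a b c) =
      prod.map (𝟙 _) (FHcomp A a b c) ≫ prod.map (FHs A c d e) (𝟙 _) := by ext <;> simp
    rw [reassoc_of% this, FHcomp_s]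
    simp only [← Category.assoc]
    congr 1
    ext
    · simp
    · simp only [prod.map_snd, Category.assoc]
      simp only [← Category.assoc]
      congr 1
      ext <;> simp
  · have : prod.map (FHe A c) (𝟙 _) ≫ (Limits.prod.associator (FH A c c) (FH A b c)
        (FH A a b)).inv =
      (Limits.prod.associator _ _ _).inv ≫ prod.map (prod.map (FHe A c) (𝟙 _)) (𝟙 _) := by
      ext <;> simp
    rw [reassoc_of% this, prod.map_map_assoc, FHcomp_e]
    simp only [← Category.assoc]
    congr 1
    ext <;> simp
  · intro d e
    have : prod.map (FHs A c d e) (𝟙 _) ≫ (Limits.prod.associator (FH A c e) (FH A b c)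
        (FH A a b)).inv =
      (Limits.prod.associator _ _ _).inv ≫ prod.map (prod.map (FHs A c d e) (𝟙 _)) (𝟙 _) := by
      ext <;> simp
    have h3 : prod.map ((Limits.prod.associator (A.hom d e) (FH A c d) (FH A b c)).hom ≫
        prod.map (𝟙 _) (FHcomp A b c d) ≫ FHs A b d e) (𝟙 (FH A a b)) ≫ FHcomp A a b e =
        prod.map ((Limits.prod.associator (A.hom d e) (FH A c d) (FH A b c)).hom ≫
        prod.map (𝟙 _) (FHcomp A b c d)) (𝟙 (FH A a b)) ≫ prod.map (FHs A b d e) (𝟙 _) ≫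
          FHcomp A a b e := by
      rw [prod.map_map_assoc]; simp
    rw [reassoc_of% this, prod.map_map_assoc, FHcomp_s, Category.comp_id, h3, FHcomp_s]
    simp only [← Category.assoc]
    congr 1
    ext
    · simp
    · simp only [prod.map_snd, Category.assoc]
      simp only [← Category.assoc]
      congr 1
      ext
      · simp
        simp only [← Category.assoc]
        congr 1
        ext <;> simp
      · simp

noncomputable def FC : VCat V where
  Obj := A.Obj
  hom := FH A
  eId := FHe A
  comp := FHcomp A
  comp_unit := FHcomp_unit A
  unit_comp := FHunit_comp A
  comp_assoc := FHcomp_assoc A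

end FreeCat
end Helpers
set_option linter.unusedSectionVars false

section Helpers2

attribute [local simp] prod.lift_fst prod.lift_snd prod.lift_fst_assoc prod.lift_snd_assoc

variable [HasFiniteProducts V] [HasCoproducts.{0} V]
variable [∀ (X : V) (J : Type), PreservesColimitsOfShape (Discrete J) (prod.functor.obj X)]

section Ext
variable (A : VGph V)

noncomputable def FHη (a b : A.Obj) : A.hom a b ⟶ FH A a b :=
  prod.lift (𝟙 _) (terminal.from _ ≫ FHe A a) ≫ FHs A a a b

theorem FHs_eq (a b c : A.Obj) :
    prod.map (FHη A b c) (𝟙 _) ≫ FHcomp A a b c = FHs A a b c := by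
  have h1 : prod.map (FHη A b c) (𝟙 (FH A a b)) =
      prod.map (prod.lift (𝟙 _) (terminal.from _ ≫ FHe A b)) (𝟙 _) ≫
        prod.map (FHs A b b c) (𝟙 _) := by
    rw [FHη]; ext <;> simp
  rw [h1, Category.assoc, FHcomp_s]
  simp only [← Category.assoc]
  convert Category.id_comp _
  ext
  · simp
  · have h2 : prod.map (prod.lift (𝟙 (A.hom b c)) (terminal.from _ ≫ FHe A b)) (𝟙 (FH A a b)) ≫
        (Limits.prod.associator _ _ _).hom ≫ prod.snd =
        prod.map (terminal.from _) (𝟙 _) ≫ prod.map (FHe A b) (𝟙 (FH A a b)) := by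
      ext <;> simp
    simp only [Category.assoc, prod.map_snd]
    rw [reassoc_of% h2, FHcomp_e]
    simp

variable {A} {C : VCat V} (φ : A.Obj → C.Obj) (f : ∀ a b, A.hom a b ⟶ C.hom (φ a) (φ b))

noncomputable def FHext (a b : A.Obj) : FH A a b ⟶ C.hom (φ a) (φ b) :=
  FHrec0 A (Z := fun b => C.hom (φ a) (φ b)) (C.eId (φ a))
    (fun b c => prod.map (f b c) (𝟙 _) ≫ C.comp _ _ _) b

theorem FHext_e (a : A.Obj) : FHe A a ≫ FHext φ f a a = C.eId (φ a) :=
  FHrec0_e A (Z := fun b => C.hom (φ a) (φ b)) _ _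

theorem FHext_s (a b c : A.Obj) : FHs A a b c ≫ FHext φ f a c =
    prod.map (f b c) (FHext φ f a b) ≫ C.comp _ _ _ := by
  have := FHrec0_s A (Z := fun b => C.hom (φ a) (φ b)) (C.eId (φ a))
    (fun b c => prod.map (f b c) (𝟙 _) ≫ C.comp _ _ _) b c
  refine this.trans ?_
  rw [prod.map_map_assoc, Category.id_comp, Category.comp_id]
  rfl

theorem FHext_comp (a b c : A.Obj) : FHcomp A a b c ≫ FHext φ f a c =
    prod.map (FHext φ f b c) (FHext φ f a b) ≫ C.comp _ _ _ := by
  have h1 := FHrec_unique A (Z := fun c => C.hom (φ a) (φ c)) (FHext φ f a b)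
    (fun b c => prod.map (f b c) (𝟙 _) ≫ C.comp _ _ _)
    (fun c => FHcomp A a b c ≫ FHext φ f a c) ?_ ?_ c
  have h2 := FHrec_unique A (Z := fun c => C.hom (φ a) (φ c)) (FHext φ f a b)
    (fun b c => prod.map (f b c) (𝟙 _) ≫ C.comp _ _ _)
    (fun c => prod.map (FHext φ f b c) (FHext φ f a b) ≫ C.comp _ _ _) ?_ ?_ c
  · exact h1.trans h2.symm
  · rw [prod.map_map_assoc, FHext_e, Category.id_comp]
    have : prod.map (C.eId (φ b)) (FHext φ f a b) =
      prod.snd ≫ FHext φ f a b ≫ prod.lift (terminal.from _ ≫ C.eId _) (𝟙 _) := by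
      ext
      · simp only [prod.map_fst, Category.assoc, prod.lift_fst]
        simp only [← Category.assoc]
        congr 1
        ext
      · simp
    rw [this, Category.assoc, Category.assoc, C.comp_unit, Category.comp_id]
  · intro c d
    have h3 : prod.map (FHs A b c d ≫ FHext φ f b d) (𝟙 _ ≫ FHext φ f a b) =
      prod.map (prod.map (f c d) (FHext φ f b c)) (FHext φ f a b) ≫
        prod.map (C.comp _ _ _) (𝟙 _) := by
      rw [FHext_s]; ext <;> simp
    rw [prod.map_map_assoc, h3, Category.assoc, C.comp_assoc]
    simp only [← Category.assoc]
    congr 1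
    ext
    · simp
    · simp only [prod.map_snd, Category.assoc, Category.comp_id]
      simp only [← Category.assoc]
      congr 1
      ext <;> simp
  · rw [← Category.assoc, FHcomp_e]
  · intro c d
    rw [← Category.assoc, FHcomp_s]
    simp only [Category.assoc]
    rw [FHext_s]
    simp only [← Category.assoc]
    congr 1
    ext <;> simp

theorem FHη_ext (a b : A.Obj) : FHη A a b ≫ FHext φ f a b = f a b := by
  rw [FHη, Category.assoc, FHext_s]
  have : prod.lift (𝟙 _) (terminal.from _ ≫ FHe A a) ≫ prod.map (f a b) (FHext φ f a a) =
    f a b ≫ prod.lift (𝟙 _) (terminal.from _ ≫ C.eId _) := by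
    ext
    · simp
    · simp only [prod.map_snd, prod.lift_snd_assoc, Category.assoc, prod.lift_snd, FHext_e]
      simp only [← Category.assoc]
      congr 1
      ext
  rw [reassoc_of% this, C.unit_comp, Category.comp_id]

theorem FHext_unique (G : ∀ a b, FH A a b ⟶ C.hom (φ a) (φ b))
    (Ge : ∀ a, FHe A a ≫ G a a = C.eId (φ a))
    (Gc : ∀ a b c, FHcomp A a b c ≫ G a c = prod.map (G b c) (G a b) ≫ C.comp _ _ _)
    (Gη : ∀ a b, FHη A a b ≫ G a b = f a b) (a b : A.Obj) : G a b = FHext φ f a b := by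
  refine FHrec0_unique A (Z := fun b => C.hom (φ a) (φ b)) _ _ (G a) (Ge a) ?_ b
  intro b c
  rw [← FHs_eq, Category.assoc, Gc, prod.map_map_assoc, prod.map_map_assoc, Gη]
  simp

end Ext


theorem VGphHom.ext2 {A B : VGph V} {φ : A.Obj → B.Obj}
    {p q : ∀ a a', A.hom a a' ⟶ B.hom (φ a) (φ a')} (h : ∀ a a', p a a' = q a a') :
    (⟨φ, p⟩ : VGphHom A B) = ⟨φ, q⟩ := by
  have : p = q := by funext a a'; exact h a a'
  rw [this]

theorem VCatHom.ext2 {A B : VCat V} {F G : VCatHom A B} (φ : A.Obj → B.Obj)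
    (p q : ∀ a a', A.hom a a' ⟶ B.hom (φ a) (φ a')) (h : ∀ a a', p a a' = q a a')
    (hF : F.toFun = φ) (hFp : HEq F.app p) (hG : G.toFun = φ) (hGq : HEq G.app q) : F = G := by
  have : p = q := by funext a a'; exact h a a'
  subst this
  exact VCatHom.ext' (hF.trans hG.symm) (hFp.trans hGq.symm)

noncomputable def toGph (A : VGph V) (C : VCat V) (G : VCatHom (FC A) C) :
    VGphHom A ((forgetToGph (V := V)).obj C) :=
  ⟨G.toFun, fun a b => FHη A a b ≫ G.app a b⟩

noncomputable def toCat (A : VGph V) (C : VCat V) (f : VGphHom A ((forgetToGph (V := V)).obj C)) :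
    VCatHom (FC A) C :=
  ⟨f.toFun, FHext (C := C) f.toFun f.app, FHext_e (C := C) f.toFun f.app,
    FHext_comp (C := C) f.toFun f.app⟩

noncomputable def FCequiv (A : VGph V) (C : VCat V) :
    (FC A ⟶ C) ≃ (A ⟶ (forgetToGph (V := V)).obj C) where
  toFun G := toGph A C G
  invFun f := toCat A C f
  left_inv G := VCatHom.ext2 G.toFun _ G.app
    (fun a b => (FHext_unique (C := C) G.toFun (fun a b => FHη A a b ≫ G.app a b) G.app
      G.map_id G.map_comp (fun _ _ => rfl) a b).symm) rfl HEq.rfl rfl HEq.rfl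
  right_inv f := VGphHom.ext2 (A := A) (B := forgetToGph.obj C) (φ := f.toFun) (q := f.app)
    (fun a b => FHη_ext (C := C) f.toFun f.app a b)

theorem FCequiv_nat (A : VGph V) (C D : VCat V) (g : C ⟶ D) (h : FC A ⟶ C) :
    FCequiv A D (h ≫ g) = FCequiv A C h ≫ (forgetToGph (V := V)).map g :=
  VGphHom.ext2 (A := A) (B := forgetToGph.obj D)
      (φ := fun a => g.toFun (h.toFun a))
      (p := fun a b => FHη A a b ≫ (h.app a b ≫ g.app _ _))
      (q := fun a b => (FHη A a b ≫ h.app a b) ≫ g.app _ _)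
      (fun _ _ => (Category.assoc _ _ _).symm)

noncomputable def FCL : VGph V ⥤ VCat V :=
  Adjunction.leftAdjointOfEquiv (G := forgetToGph (V := V)) (F_obj := FC) FCequiv FCequiv_nat

noncomputable def FCadj : FCL ⊣ forgetToGph (V := V) :=
  Adjunction.adjunctionOfEquivLeft (G := forgetToGph (V := V)) (F_obj := FC) FCequiv FCequiv_nat

noncomputable def FCε (C : VCat V) : VCatHom (FC (forgetToGph.obj C)) C :=
  (FCequiv _ C).symm (𝟙 _)

theorem FCadj_counit (C : VCat V) : FCadj.counit.app C = FCε C := rfl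

theorem FCadj_unit (A : VGph V) :
    FCadj.unit.app A = (⟨fun a => a, FHη A⟩ : VGphHom A (forgetToGph.obj (FC A))) := by
  have : FCadj.unit.app A = FCequiv A (FC A) (𝟙 _) := rfl
  rw [this]
  exact VGphHom.ext2 (A := A) (B := forgetToGph.obj (FC A)) (φ := fun a => a)
      (p := fun a b => FHη A a b ≫ 𝟙 _)
      (q := FHη A) (fun a b => Category.comp_id _)

theorem tr_comp {Fab Fbc Fac Aab Abc Aac Bab Bbc Bac : V} (cF : Fbc ⨯ Fab ⟶ Fac)
    (cA : Abc ⨯ Aab ⟶ Aac) (cB : Bbc ⨯ Bab ⟶ Bac) (ηab : Aab ⟶ Fab) (ηbc : Abc ⟶ Fbc)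
    (εab : Fab ⟶ Aab) (εbc : Fbc ⟶ Abc) (εac : Fac ⟶ Aac)
    (fab : Aab ⟶ Bab) (fbc : Abc ⟶ Bbc) (fac : Aac ⟶ Bac)
    (hab : ηab ≫ εab = 𝟙 _) (hbc : ηbc ≫ εbc = 𝟙 _)
    (hε : cF ≫ εac = prod.map εbc εab ≫ cA)
    (hG : cF ≫ (εac ≫ fac) = prod.map (εbc ≫ fbc) (εab ≫ fab) ≫ cB) :
    cA ≫ fac = prod.map fbc fab ≫ cB := by
  rw [reassoc_of% hε] at hG
  have h6 := congrArg (fun t => prod.map ηbc ηab ≫ t) hG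
  simp only [prod.map_map_assoc] at h6
  rw [hab, hbc, reassoc_of% hab, reassoc_of% hbc] at h6
  simpa using h6

theorem tr_key {Fab Fbc Fac Aab Abc Aac Tab Tbc Tac : V} (cF : Fbc ⨯ Fab ⟶ Fac)
    (cT : Tbc ⨯ Tab ⟶ Tac) (ηab : Aab ⟶ Fab) (ηbc : Abc ⟶ Fbc)
    (τab : Fab ⟶ Tab) (τbc : Fbc ⟶ Tbc)
    (εab : Tab ⟶ Fab) (εbc : Tbc ⟶ Fbc) (εac : Tac ⟶ Fac)
    (mab : Tab ⟶ Fab) (mbc : Tbc ⟶ Fbc) (mac : Tac ⟶ Fac)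
    (αab : Fab ⟶ Aab) (αbc : Fbc ⟶ Abc) (αac : Fac ⟶ Aac)
    (hab : τab ≫ εab = 𝟙 _) (hbc : τbc ≫ εbc = 𝟙 _)
    (mhab : τab ≫ mab = αab ≫ ηab) (mhbc : τbc ≫ mbc = αbc ≫ ηbc)
    (hε : cT ≫ εac = prod.map εbc εab ≫ cF)
    (hm : cT ≫ mac = prod.map mbc mab ≫ cF)
    (hα : εac ≫ αac = mac ≫ αac) :
    cF ≫ αac = prod.map αbc αab ≫ (prod.map ηbc ηab ≫ cF ≫ αac) := by
  rw [prod.map_map_assoc, ← mhab, ← mhbc, ← prod.map_map_assoc, ← reassoc_of% hm, ← hα,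
    reassoc_of% hε, prod.map_map_assoc, hab, hbc]
  simp

/-- Transport of a category structure along a split epi. -/
noncomputable def trCat (F : VCat V) (hom : F.Obj → F.Obj → V)
    (α : ∀ a b, F.hom a b ⟶ hom a b) (η : ∀ a b, hom a b ⟶ F.hom a b)
    (hη : ∀ a b, η a b ≫ α a b = 𝟙 _)
    (comp : ∀ a b c, hom b c ⨯ hom a b ⟶ hom a c)
    (key : ∀ a b c, F.comp a b c ≫ α a c = prod.map (α b c) (α a b) ≫ comp a b c) : VCat V where
  Obj := F.Obj
  hom := hom
  eId a := F.eId a ≫ α a a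
  comp := comp
  comp_unit a b := by
    have : prod.lift (terminal.from (hom a b) ≫ F.eId b ≫ α b b) (𝟙 (hom a b)) =
        η a b ≫ prod.lift (terminal.from _ ≫ F.eId b) (𝟙 _) ≫ prod.map (α b b) (α a b) := by
      ext
      · simp only [prod.lift_fst, prod.map_fst, Category.assoc, prod.lift_fst_assoc]
        simp only [← Category.assoc]
        congr 2
        ext
      · simp [hη]
    rw [this, Category.assoc, Category.assoc, ← key, reassoc_of% F.comp_unit, hη]
  unit_comp a b := by
    have : prod.lift (𝟙 (hom a b)) (terminal.from (hom a b) ≫ F.eId a ≫ α a a) =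
        η a b ≫ prod.lift (𝟙 _) (terminal.from _ ≫ F.eId a) ≫ prod.map (α a b) (α a a) := by
      ext
      · simp [hη]
      · simp only [prod.lift_snd, prod.map_snd, Category.assoc, prod.lift_snd_assoc]
        simp only [← Category.assoc]
        congr 2
        ext
    rw [this, Category.assoc, Category.assoc, ← key, reassoc_of% F.unit_comp, hη]
  comp_assoc a b c d := by
    have h1 : 𝟙 _ = prod.map (prod.map (η c d) (η b c)) (η a b) ≫
        prod.map (prod.map (α c d) (α b c)) (α a b) := by
      simp [hη]
    rw [← Category.id_comp (prod.map _ _ ≫ comp a b d), h1, Category.assoc]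
    conv_rhs => rw [← Category.id_comp ((Limits.prod.associator _ _ _).hom ≫ _), h1,
      Category.assoc]
    congr 1
    have h2 : prod.map (prod.map (α c d) (α b c)) (α a b) ≫
        (Limits.prod.associator _ _ _).hom = (Limits.prod.associator _ _ _).hom ≫
        prod.map (α c d) (prod.map (α b c) (α a b)) := by
      ext <;> simp
    have h3 : prod.map (F.comp b c d ≫ α b d) (α a b) =
        prod.map (F.comp b c d) (𝟙 _) ≫ prod.map (α b d) (α a b) := by simp
    have h4 : prod.map (α c d) (F.comp a b c ≫ α a c) =
        prod.map (𝟙 _) (F.comp a b c) ≫ prod.map (α c d) (α a c) := by simp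
    rw [reassoc_of% h2, prod.map_map_assoc, prod.map_map_assoc, ← key, ← key, Category.comp_id,
      Category.comp_id, h3, h4, Category.assoc, Category.assoc, ← key, ← key,
      reassoc_of% F.comp_assoc]

theorem FCε_η (C : VCat V) (a b : C.Obj) :
    FHη (forgetToGph.obj C) a b ≫ (FCε C).app a b = 𝟙 (C.hom a b) :=
  FHη_ext (A := forgetToGph.obj C) (C := C) (fun a => a) (fun a b => 𝟙 (C.hom a b)) a b

theorem full_aux {A B : VCat V} (f : VGphHom (forgetToGph.obj A) (forgetToGph.obj B))
    (G : VCatHom (FC (forgetToGph.obj A)) B) (hG : (⟨G.toFun, G.app⟩ :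
      VGphHom (forgetToGph.obj (FC (forgetToGph.obj A))) (forgetToGph.obj B)) =
      ⟨fun a => f.toFun a, fun a b => (FCε A).app a b ≫ f.app _ _⟩) :
    ∃ g : A ⟶ B, forgetToGph.map g = f := by
  obtain ⟨G0, G, Ge, Gc⟩ := G
  obtain ⟨f0, f⟩ := f
  have h0 : G0 = f0 := congrArg VGphHom.toFun hG
  subst h0
  have h1 : G = fun a b => (FCε A).app a b ≫ f a b := by
    have := (VGphHom.mk.injEq _ _ _ _).mp hG
    exact eq_of_heq this.2
  subst h1
  refine ⟨(⟨G0, f, ?_, ?_⟩ : VCatHom A B), rfl⟩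
  · intro a
    have h4 : FHe (forgetToGph.obj A) a ≫ (FCε A).app a a = A.eId a := (FCε A).map_id a
    have h5 := Ge a
    rw [← h4]
    exact (Category.assoc _ _ _).trans h5
  · intro a b c
    exact tr_comp _ _ _ _ _ _ _ _ _ _ _ (FCε_η A a b) (FCε_η A b c)
      ((FCε A).map_comp a b c) (Gc a b c)

end Helpers2
section Helpers3
variable [HasFiniteProducts V] [HasCoproducts.{0} V]
variable [∀ (X : V) (J : Type), PreservesColimitsOfShape (Discrete J) (prod.functor.obj X)]

noncomputable def FCM {A B : VGph V} (f : VGphHom A B) : VCatHom (FC A) (FC B) :=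
  FCL.map (show A ⟶ B from f)

theorem FCM_η {A B : VGph V} (f : VGphHom A B) (a b : A.Obj) :
    FHη A a b ≫ (FCM f).app a b = f.app a b ≫ FHη B _ _ := by
  have := FHη_ext (A := A) (C := FC B) f.toFun (fun a b => f.app a b ≫ (FHη B _ _ ≫ 𝟙 _)) a b
  refine this.trans ?_
  exact congrArg (fun t => f.app a b ≫ t) (Category.comp_id (FHη B (f.toFun a) (f.toFun b)))

theorem ess_aux (A : VGph V) (α : VGphHom (forgetToGph.obj (FC A)) A)
    (hu : (⟨fun a => α.toFun a, fun a b => FHη A a b ≫ α.app a b⟩ : VGphHom A A) =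
      ⟨fun a => a, fun a b => 𝟙 _⟩)
    (ha : (⟨fun a => α.toFun a, fun a b => (FCε (FC A)).app a b ≫ α.app a b⟩ :
        VGphHom (forgetToGph.obj (FC (forgetToGph.obj (FC A)))) A) =
      ⟨fun a => α.toFun (α.toFun a), fun a b => (FCM α).app a b ≫ α.app _ _⟩) :
    ∃ C : VCat V, ∃ i : forgetToGph.obj C ≅ A,
      forgetToGph.map (FCL.map i.hom) ≫ (show forgetToGph.obj (FCL.obj A) ⟶ A from α) =
        forgetToGph.map (FCadj.counit.app C) ≫ i.hom := by
  obtain ⟨α0, α⟩ := α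
  have h0 : α0 = fun a => a := congrArg VGphHom.toFun hu
  subst h0
  have hu' : ∀ a b, FHη A a b ≫ α a b = 𝟙 _ := by
    have := eq_of_heq ((VGphHom.mk.injEq _ _ _ _).mp hu).2
    intro a b
    exact congrFun (congrFun this a) b
  have ha' : ∀ a b, (FCε (FC A)).app a b ≫ α a b = 
      (FCM (⟨fun a => a, α⟩ : VGphHom (forgetToGph.obj (FC A)) A)).app a b ≫ α a b := by
    have := eq_of_heq ((VGphHom.mk.injEq _ _ _ _).mp ha).2
    intro a b
    exact congrFun (congrFun this a) b
  have key : ∀ a b c, FHcomp A a b c ≫ α a c = prod.map (α b c) (α a b) ≫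
      (prod.map (FHη A b c) (FHη A a b) ≫ FHcomp A a b c ≫ α a c) := by
    intro a b c
    exact tr_key (FHcomp A a b c) (FHcomp (forgetToGph.obj (FC A)) a b c) _ _
      (FHη (forgetToGph.obj (FC A)) a b) (FHη (forgetToGph.obj (FC A)) b c) _ _ _ _ _ _ _ _ _
      (FCε_η (FC A) a b) (FCε_η (FC A) b c)
      (FCM_η (⟨fun a => a, α⟩ : VGphHom (forgetToGph.obj (FC A)) A) a b)
      (FCM_η (⟨fun a => a, α⟩ : VGphHom (forgetToGph.obj (FC A)) A) b c)
      ((FCε (FC A)).map_comp a b c)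
      ((FCM (⟨fun a => a, α⟩ : VGphHom (forgetToGph.obj (FC A)) A)).map_comp a b c)
      (ha' a c)
  let C : VCat V := trCat (FC A) A.hom α (FHη A) hu' _ key
  let αh : VCatHom (FC A) C := ⟨fun a => a, α, fun a => rfl, key⟩
  refine ⟨C, Iso.refl A, ?_⟩
  have hε : FCadj.counit.app C = αh := by
    change (FCequiv A C).symm (𝟙 A) = αh
    refine (Equiv.symm_apply_eq (FCequiv A C)).mpr ?_
    exact (VGphHom.ext2 (A := A) (B := A) (φ := fun a => a)
      (p := fun a b => FHη A a b ≫ α a b) (q := fun a b => 𝟙 _) hu').symm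
  rw [hε]
  have : forgetToGph.map (FCL.map (𝟙 A)) = 𝟙 (forgetToGph.obj (FCL.obj A)) := by
    rw [FCL.map_id]; exact CategoryTheory.Functor.map_id _ _
  refine (congrArg (fun t => t ≫ (show forgetToGph.obj (FCL.obj A) ⟶ A from ⟨fun a => a, α⟩))
    this).trans ?_
  refine (Category.id_comp _).trans ?_
  exact (Category.comp_id (show forgetToGph.obj (FCL.obj A) ⟶ A from ⟨fun a => a, α⟩)).symm

theorem comparison_eqv : (Monad.comparison (FCadj (V := V))).IsEquivalence := by
  have hfaith : (Monad.comparison (FCadj (V := V))).Faithful := by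
    constructor
    intro A B f g h
    have h1 : (forgetToGph (V := V)).map f = forgetToGph.map g := congrArg Monad.Algebra.Hom.f h
    obtain ⟨f0, f, _, _⟩ := f
    obtain ⟨g0, g, _, _⟩ := g
    have h2 := (VGphHom.mk.injEq _ _ _ _).mp h1
    exact VCatHom.ext' h2.1 h2.2
  have hfull : (Monad.comparison (FCadj (V := V))).Full := by
    constructor
    intro A B f
    obtain ⟨g, hg⟩ := full_aux (A := A) (B := B) f.f
      (FCL.map f.f ≫ FCadj.counit.app B) f.h
    exact ⟨g, Monad.Algebra.Hom.ext hg⟩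
  have hess : (Monad.comparison (FCadj (V := V))).EssSurj := by
    constructor
    rintro ⟨A, α, hu, ha⟩
    have hu2 := hu
    rw [show FCadj.toMonad.η.app A = _ from FCadj_unit A] at hu2
    obtain ⟨C, i, hi⟩ := ess_aux A α hu2 ha
    exact ⟨C, ⟨Monad.Algebra.isoMk i hi⟩⟩
  exact { }

end Helpers3
section Helpers4

def Pth.ofFun {X : Type} : (k : ℕ) → (c : Fin (k+1) → X) → Pth X (c 0) (c (Fin.last k))
  | 0, c => Pth.nil
  | k+1, c => Pth.cons (Pth.ofFun k (fun i => c i.castSucc)) (c (Fin.last (k+1)))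

def Pth.tot {X : Type} {a : X} : {b : X} → Pth X a b → Σ k : ℕ, (Fin (k+1) → X)
  | _, .nil => ⟨0, fun _ => a⟩
  | _, .cons p c => ⟨p.tot.1 + 1, Fin.snoc (α := fun _ => X) p.tot.2 c⟩

theorem Pth.tot_ofFun {X : Type} : (k : ℕ) → (c : Fin (k+1) → X) →
    (Pth.ofFun k c).tot = ⟨k, c⟩
  | 0, c => by
    simp only [Pth.ofFun, Pth.tot]
    congr 1
    funext i
    have h : i = 0 := Fin.fin_one_eq_zero i
    rw [h]
  | k+1, c => by
    have ih := Pth.tot_ofFun k (fun i => c i.castSucc)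
    have h : (Pth.ofFun (k+1) c).tot =
      ⟨(Pth.ofFun k (fun i => c i.castSucc)).tot.1 + 1,
        Fin.snoc (α := fun _ => X) (Pth.ofFun k (fun i => c i.castSucc)).tot.2
          (c (Fin.last (k+1)))⟩ := rfl
    rw [h]
    have h2 : ∀ s : (Σ k : ℕ, (Fin (k+1) → X)), s = ⟨k, fun i => c i.castSucc⟩ →
        (⟨s.1 + 1, Fin.snoc (α := fun _ => X) s.2 (c (Fin.last (k+1)))⟩ :
          Σ k : ℕ, (Fin (k+1) → X)) = ⟨k+1, c⟩ := by
      rintro s rfl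
      congr 1
      exact Fin.snoc_init_self (α := fun _ => X) c
    exact h2 _ ih

def Pth.castEnds {X : Type} {a b a' b' : X} (h : a = a') (h' : b = b') (p : Pth X a b) :
    Pth X a' b' := h ▸ h' ▸ p

theorem Pth.tot_castEnds {X : Type} {a b a' b' : X} (h : a = a') (h' : b = b')
    (p : Pth X a b) : (p.castEnds h h').tot = p.tot := by
  subst h; subst h'; rfl

def Pth.ofChain (A : VGph V) (a a' : A.Obj) (c : Chains A a a') : Pth A.Obj a a' :=
  (Pth.ofFun c.1 c.2.1).castEnds c.2.2.1 c.2.2.2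

theorem Pth.ofChain_inj (A : VGph V) (a a' : A.Obj) :
    Function.Injective (Pth.ofChain A a a') := by
  rintro ⟨k, c, h0, h1⟩ ⟨l, d, h2, h3⟩ h
  have := congrArg Pth.tot h
  simp only [Pth.ofChain, Pth.tot_castEnds, Pth.tot_ofFun] at this
  obtain ⟨rfl, h⟩ := Sigma.mk.inj_iff.mp this
  cases h
  rfl

theorem Pth.ofChain_surj (A : VGph V) (a a' : A.Obj) :
    Function.Surjective (Pth.ofChain A a a') := by
  intro p
  induction p with
  | nil => exact ⟨⟨0, fun _ => a, rfl, rfl⟩, rfl⟩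
  | cons p e ih =>
    obtain ⟨⟨k, c, h0, h1⟩, rfl⟩ := ih
    refine ⟨⟨k+1, Fin.snoc (α := fun _ => A.Obj) c e, ?_, ?_⟩, ?_⟩
    · subst h0
      exact Fin.snoc_castSucc (α := fun _ => A.Obj) e c 0
    · exact Fin.snoc_last (α := fun _ => A.Obj) e c
    · subst h0; subst h1
      have : ∀ (c' : Fin (k+1) → A.Obj) (e' : A.Obj) (hc : c' = c) (he : e' = e)
        (h : c' 0 = c 0),
        (Pth.cons (Pth.ofFun k c') e').castEnds h he = Pth.cons (Pth.ofFun k c) e := by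
        rintro c' e' rfl rfl h
        rfl
      exact this (fun i => Fin.snoc (α := fun _ => A.Obj) c e i.castSucc) _
        (funext fun i => Fin.snoc_castSucc (α := fun _ => A.Obj) e c i)
        (Fin.snoc_last (α := fun _ => A.Obj) e c) _

variable [HasFiniteProducts V]

noncomputable def piLastIso {k : ℕ} (f : Fin (k+1) → V) :
    (f (Fin.last k) ⨯ ∏ᶜ fun i : Fin k => f i.castSucc) ≅ ∏ᶜ f where
  hom := Pi.lift (Fin.lastCases prod.fst (fun i => prod.snd ≫ Pi.π _ i))
  inv := prod.lift (Pi.π f (Fin.last k)) (Pi.lift fun i => Pi.π f i.castSucc)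
  hom_inv_id := by
    apply Limits.prod.hom_ext
    · rw [Category.assoc, prod.lift_fst, Pi.lift_π, Fin.lastCases_last, Category.id_comp]
    · apply Pi.hom_ext
      intro i
      rw [Category.assoc _ _ prod.snd, prod.lift_snd, Category.assoc, Pi.lift_π, Pi.lift_π,
        Fin.lastCases_castSucc, Category.id_comp]
  inv_hom_id := by
    apply Pi.hom_ext
    intro i
    rw [Category.assoc, Pi.lift_π, Category.id_comp]
    induction i using Fin.lastCases with
    | last => rw [Fin.lastCases_last, prod.lift_fst]
    | cast i => rw [Fin.lastCases_castSucc, prod.lift_snd_assoc, Pi.lift_π]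

noncomputable def ofFunIso (A : VGph V) : (k : ℕ) → (c : Fin (k+1) → A.Obj) →
    ((Pth.ofFun k c).obj A ≅ ∏ᶜ fun i : Fin k => A.hom (c i.castSucc) (c i.succ))
  | 0, c =>
    { hom := Pi.lift (fun i => i.elim0)
      inv := terminal.from _
      hom_inv_id := terminal.hom_ext _ _
      inv_hom_id := Pi.hom_ext _ _ (fun i => i.elim0) }
  | k+1, c =>
    prod.mapIso (Iso.refl _) (ofFunIso A k (fun i => c i.castSucc)) ≪≫
      piLastIso (fun i : Fin (k+1) => A.hom (c i.castSucc) (c i.succ))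

noncomputable def castEndsIso (A : VGph V) {a b a' b' : A.Obj} (h : a = a') (h' : b = b')
    (p : Pth A.Obj a b) : (p.castEnds h h').obj A ≅ p.obj A :=
  eqToIso (by subst h; subst h'; rfl)

variable [HasCoproducts.{0} V]

noncomputable def freeHomIso (A : VGph V) (a a' : A.Obj) : FH A a a' ≅ freeHomObj A a a' :=
  (Sigma.whiskerEquiv (Equiv.ofBijective (Pth.ofChain A a a')
    ⟨Pth.ofChain_inj A a a', Pth.ofChain_surj A a a'⟩)
    (fun c => castEndsIso A c.2.2.1 c.2.2.2 (Pth.ofFun c.1 c.2.1) ≪≫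
      ofFunIso A c.1 c.2.1)).symm

end Helpers4

/-- If `V` has finite products and small coproducts commuting with finite products,
then the forgetful functor `V-Cat ⟶ V-Gph` is monadic, and the induced free
`V`-category monad is the identity on object sets and is given on hom-objects by
the free-category formula. -/
theorem stmt_6 (V : Type u) [Category.{v} V] [HasFiniteProducts V]
    [HasCoproducts.{0} V]
    (Hcomm : ∀ (X : V) (J : Type),
      PreservesColimitsOfShape (Discrete J) (prod.functor.obj X)) :
    ∃ M : MonadicRightAdjoint (forgetToGph (V := V)),
      ∀ A : VGph V, ∃ h : ((M.adj.toMonad : VGph V ⥤ VGph V).obj A).Obj = A.Obj,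
        ∀ a a' : A.Obj,
          Nonempty
            (((M.adj.toMonad : VGph V ⥤ VGph V).obj A).hom
                (cast h.symm a) (cast h.symm a') ≅ freeHomObj A a a') := by
  haveI := Hcomm
  exact ⟨{ L := FCL, adj := FCadj, eqv := comparison_eqv },
    fun A => ⟨rfl, fun a a' => ⟨freeHomIso A a a'⟩⟩⟩
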